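/- Let (F, v) be a Henselian valued field with residue field F̄. Then the epimorphism ρ : G(F) → G(F̄) induced by reduction at v has a continuous group-theoretic section; in particular G(F̄) is isomorphic to a closed subgroup of G(F) and the quotient map splits. -/

import Mathlib

/-- A valued field `(F, v)` is Henselian if `v` extends uniquely (up to equivalence)
to every algebraic extension of `F`. -/
def IsHenselianValuedField (F : Type) [Field F] {Γ : Type}
    [LinearOrderedCommGroupWithZero Γ] (v : Valuation F Γ) : Prop :=
  ∀ (L : Type) [Field L] [Algebra F L], Algebra.IsAlgebraic F L →
    ∀ (Γ₁ Γ₂ : Type) [LinearOrderedCommGroupWithZero Γ₁] [LinearOrderedCommGroupWithZero Γ₂]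
      (w₁ : Valuation L Γ₁) (w₂ : Valuation L Γ₂),
      (w₁.comap (algebraMap F L)).IsEquiv v → (w₂.comap (algebraMap F L)).IsEquiv v →
      w₁.IsEquiv w₂

section

section Helpers

set_option linter.unusedSectionVars false
set_option linter.style.haveILetI false
open Polynomial

/-- The data of the theorem, bundled. -/
structure RedData {F : Type} [Field F] {Γ : Type} [LinearOrderedCommGroupWithZero Γ]
    (v : Valuation F Γ)
    {Ω : Type} [Field Ω] [Algebra F Ω]
    {Γ' : Type} [LinearOrderedCommGroupWithZero Γ'] (w : Valuation Ω Γ')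
    {ks : Type} [Field ks]
    [Algebra (IsLocalRing.ResidueField ↥v.valuationSubring) ks]
    (ι : ks →+* IsLocalRing.ResidueField ↥w.valuationSubring)
    (ρ : (Ω ≃ₐ[F] Ω) →* (ks ≃ₐ[IsLocalRing.ResidueField ↥v.valuationSubring] ks)) : Prop where
  mem_iff : ∀ x : F, algebraMap F Ω x ∈ w.valuationSubring ↔ x ∈ v.valuationSubring
  hO : ∀ (σ : Ω ≃ₐ[F] Ω) (x : Ω), x ∈ w.valuationSubring → σ x ∈ w.valuationSubring
  hι : ∀ (x : F) (hx : x ∈ v.valuationSubring) (hx' : algebraMap F Ω x ∈ w.valuationSubring),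
      ι (algebraMap (IsLocalRing.ResidueField ↥v.valuationSubring) ks
          (IsLocalRing.residue _ ⟨x, hx⟩)) = IsLocalRing.residue _ ⟨algebraMap F Ω x, hx'⟩
  hcont : Continuous ρ
  hsurj : Function.Surjective ρ
  hρ : ∀ (σ : Ω ≃ₐ[F] Ω) (x : Ω) (hx : x ∈ w.valuationSubring)
        (hσx : σ x ∈ w.valuationSubring) (y : ks),
        ι y = IsLocalRing.residue _ ⟨x, hx⟩ →
          ι (ρ σ y) = IsLocalRing.residue _ ⟨σ x, hσx⟩

section Basic

variable {F : Type} [Field F] {Γ : Type} [LinearOrderedCommGroupWithZero Γ]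
    {v : Valuation F Γ}
    {Ω : Type} [Field Ω] [Algebra F Ω] [IsSepClosure F Ω]
    {Γ' : Type} [LinearOrderedCommGroupWithZero Γ'] {w : Valuation Ω Γ'}
    {ks : Type} [Field ks]
    [Algebra (IsLocalRing.ResidueField ↥v.valuationSubring) ks]
    [IsSepClosure (IsLocalRing.ResidueField ↥v.valuationSubring) ks]
    {ι : ks →+* IsLocalRing.ResidueField ↥w.valuationSubring}
    {ρ : (Ω ≃ₐ[F] Ω) →* (ks ≃ₐ[IsLocalRing.ResidueField ↥v.valuationSubring] ks)}

theorem hens_mem (hhens : IsHenselianValuedField F v)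
    (hw : (w.comap (algebraMap F Ω)).IsEquiv v) (σ : Ω ≃ₐ[F] Ω) (x : Ω)
    (hx : x ∈ w.valuationSubring) : σ x ∈ w.valuationSubring := by
  have hG : IsGalois F Ω := inferInstance
  have h := hhens Ω inferInstance Γ' Γ' w (w.comap (σ : Ω →+* Ω)) hw (by
    have : (w.comap (σ : Ω →+* Ω)).comap (algebraMap F Ω) = w.comap (algebraMap F Ω) := by
      ext a; simp [Valuation.comap_apply]
    rw [this]; exact hw)
  have h1 := Valuation.isEquiv_iff_val_le_one.1 h (x := x)
  rw [Valuation.mem_valuationSubring_iff] at hx ⊢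
  simpa using h1.1 hx

theorem RedData.le_one (S : RedData v w ι ρ) (σ : Ω ≃ₐ[F] Ω) {x : Ω} (hx : w x ≤ 1) :
    w (σ x) ≤ 1 := by
  have := S.hO σ x
  simp only [Valuation.mem_valuationSubring_iff] at this
  exact this hx

theorem RedData.le (S : RedData v w ι ρ) (σ : Ω ≃ₐ[F] Ω) {x y : Ω} (hxy : w x ≤ w y) :
    w (σ x) ≤ w (σ y) := by
  by_cases hy : y = 0
  · subst hy
    simp only [map_zero, le_zero_iff] at hxy
    have : x = 0 := by simpa using hxy
    simp [this]
  have h1 : w (x / y) ≤ 1 := by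
    rw [map_div₀]
    exact (div_le_one₀ (zero_lt_iff.2 (by simpa using hy))).2 hxy
  have h2 := S.le_one σ h1
  rw [map_div₀, map_div₀] at h2
  exact (div_le_one₀ (zero_lt_iff.2 (by simpa using hy))).1 h2

theorem exists_pow_fix (σ : Ω ≃ₐ[F] Ω) (x : Ω) : ∃ n : ℕ, 0 < n ∧ (σ ^ n) x = x := by
  have hG : IsGalois F Ω := inferInstance
  have hx : IsIntegral F x := Algebra.IsIntegral.isIntegral x
  have hfin : ((minpoly F x).rootSet Ω).Finite := rootSet_finite _ _
  have hmem : ∀ n : ℕ, (σ ^ n) x ∈ (minpoly F x).rootSet Ω := by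
    intro n
    rw [mem_rootSet]
    refine ⟨minpoly.ne_zero hx, ?_⟩
    rw [← minpoly.algEquiv_eq (σ ^ n) x]
    exact minpoly.aeval _ _
  have := hfin.to_subtype
  obtain ⟨a, b, hab, h⟩ := Finite.exists_ne_map_eq_of_infinite
    (fun n : ℕ => (⟨(σ ^ n) x, hmem n⟩ : (minpoly F x).rootSet Ω))
  have h' : (σ ^ a) x = (σ ^ b) x := by simpa using h
  have key : ∀ a b : ℕ, a < b → (σ ^ a) x = (σ ^ b) x → ∃ n : ℕ, 0 < n ∧ (σ ^ n) x = x := by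
    intro a b hab h
    refine ⟨b - a, by omega, ?_⟩
    have h3 : (σ ^ b) x = (σ ^ a) ((σ ^ (b - a)) x) := by
      rw [← AlgEquiv.mul_apply, ← pow_add]; congr 2; omega
    rw [h3] at h
    exact ((σ ^ a).injective h).symm
  rcases lt_or_gt_of_ne hab with h1 | h1
  · exact key a b h1 h'
  · exact key b a h1 h'.symm

theorem RedData.isom (S : RedData v w ι ρ) (σ : Ω ≃ₐ[F] Ω) (x : Ω) : w (σ x) = w x := by
  obtain ⟨n, hn, hnx⟩ := exists_pow_fix σ x
  have e : ∀ m : ℕ, (σ ^ (m + 1)) x = σ ((σ ^ m) x) := by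
    intro m; rw [pow_succ', AlgEquiv.mul_apply]
  obtain ⟨m, rfl⟩ : ∃ m, n = m + 1 := ⟨n - 1, by omega⟩
  rcases le_total (w (σ x)) (w x) with h | h
  · have : ∀ m : ℕ, w ((σ ^ (m + 1)) x) ≤ w (σ x) := by
      intro m
      induction m with
      | zero => simp
      | succ m ih => rw [e]; exact (S.le σ (ih.trans h))
    have h2 := this m
    rw [hnx] at h2
    exact le_antisymm h h2
  · have : ∀ m : ℕ, w (σ x) ≤ w ((σ ^ (m + 1)) x) := by
      intro m
      induction m with
      | zero => simp
      | succ m ih => rw [e (m+1)]; exact (S.le σ (h.trans ih))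
    have h2 := this m
    rw [hnx] at h2
    exact le_antisymm h2 h

theorem roots_conj (x : Ω) {r : Ω} (hr : r ∈ ((minpoly F x).map (algebraMap F Ω)).roots) :
    ∃ σ : Ω ≃ₐ[F] Ω, r = σ x := by
  have hG : IsGalois F Ω := inferInstance
  have hx : IsIntegral F x := Algebra.IsIntegral.isIntegral x
  rw [mem_roots'] at hr
  obtain ⟨σ, hσ⟩ := minpoly.exists_algEquiv_of_root (K := F) (x := r) (y := x) hx.isAlgebraic
    (by have := hr.2; rwa [IsRoot, eval_map_algebraMap] at this)
  exact ⟨σ.symm, by rw [← hσ]; simp⟩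

theorem RedData.torsion (S : RedData v w ι ρ) (x : Ω) :
    ∃ n : ℕ, 0 < n ∧ ∃ a : F, w x ^ n = w (algebraMap F Ω a) := by
  have hG : IsGalois F Ω := inferInstance
  have hx : IsIntegral F x := Algebra.IsIntegral.isIntegral x
  have hsp : ((minpoly F x).map (algebraMap F Ω)).Splits := Normal.splits inferInstance x
  have hm : ((minpoly F x).map (algebraMap F Ω)).Monic := (minpoly.monic hx).map _
  have h := hsp.coeff_zero_eq_prod_roots_of_monic hm
  refine ⟨Multiset.card ((minpoly F x).map (algebraMap F Ω)).roots, ?_, (minpoly F x).coeff 0, ?_⟩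
  · rw [← hsp.natDegree_eq_card_roots, natDegree_map]
    exact minpoly.natDegree_pos hx
  · rw [coeff_map] at h
    rw [h, map_mul, map_pow, Valuation.map_neg, map_one, one_pow, one_mul, map_multiset_prod]
    symm
    rw [Multiset.eq_replicate_card.2 (?_ : ∀ b ∈ Multiset.map (⇑w) _, b = w x),
      Multiset.prod_replicate, Multiset.card_map]
    intro b hb
    obtain ⟨r, hr, rfl⟩ := Multiset.mem_map.1 hb
    obtain ⟨σ, rfl⟩ := roots_conj x hr
    exact S.isom σ x

theorem RedData.residue_pow_mem (S : RedData v w ι ρ) (t : w.valuationSubring) (q : ℕ)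
    [ExpChar ks q] : ∃ n : ℕ, ∃ b : ks, ι b = IsLocalRing.residue _ t ^ q ^ n := by
  have hG : IsGalois F Ω := inferInstance
  have hx : IsIntegral F (t : Ω) := Algebra.IsIntegral.isIntegral _
  have hsp : ((minpoly F (t : Ω)).map (algebraMap F Ω)).Splits := Normal.splits inferInstance _
  have hm : ((minpoly F (t : Ω)).map (algebraMap F Ω)).Monic := (minpoly.monic hx).map _
  letI : Algebra ks (IsLocalRing.ResidueField ↥w.valuationSubring) := ι.toAlgebra
  -- coefficients are integral
  have hco : ∀ i, (minpoly F (t : Ω)).coeff i ∈ v.valuationSubring := by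
    intro i
    rw [← S.mem_iff, ← coeff_map]
    have h1 : (minpoly F (t : Ω)).map (algebraMap F Ω) ∈ lifts w.valuationSubring.subtype := by
      rw [hsp.eq_prod_roots_of_monic hm]
      refine Subsemiring.multiset_prod_mem _ _ ?_
      intro f hf
      obtain ⟨r, hr, rfl⟩ := Multiset.mem_map.1 hf
      obtain ⟨σ, rfl⟩ := roots_conj _ hr
      refine ⟨X - C ⟨σ t, S.hO σ t t.2⟩, ?_⟩
      simp
    rw [lifts_iff_coeff_lifts] at h1
    obtain ⟨c, hc⟩ := h1 i
    rw [← hc]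
    exact c.2
  obtain ⟨g, hg, -, hgm⟩ := lifts_and_natDegree_eq_and_monic
    (f := v.valuationSubring.subtype) (p := minpoly F (t : Ω))
    ((lifts_iff_coeff_lifts _).2 fun i => ⟨⟨_, hco i⟩, rfl⟩) (minpoly.monic hx)
  let α : v.valuationSubring →+* w.valuationSubring :=
    ((algebraMap F Ω).comp v.valuationSubring.subtype).codRestrict w.valuationSubring.toSubring
      (fun x => (S.mem_iff _).2 x.2)
  have hev : g.eval₂ α t = 0 := by
    apply Subtype.ext
    have h2 := minpoly.aeval F (t : Ω)
    rw [← hg, aeval_def, eval₂_map] at h2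
    have := hom_eval₂ g α w.valuationSubring.subtype t
    exact this.trans h2
  have hev2 := congrArg (IsLocalRing.residue w.valuationSubring) hev
  rw [hom_eval₂, map_zero] at hev2
  have hcomp : (IsLocalRing.residue w.valuationSubring).comp α =
      (algebraMap ks (IsLocalRing.ResidueField ↥w.valuationSubring)).comp
        ((algebraMap (IsLocalRing.ResidueField ↥v.valuationSubring) ks).comp
          (IsLocalRing.residue v.valuationSubring)) := by
    ext x
    exact (S.hι x.1 x.2 ((S.mem_iff _).2 x.2)).symm
  have hintegral : IsIntegral ks (IsLocalRing.residue _ t) := by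
    refine ⟨g.map ((algebraMap (IsLocalRing.ResidueField ↥v.valuationSubring) ks).comp
          (IsLocalRing.residue v.valuationSubring)), hgm.map _, ?_⟩
    rw [eval₂_map, ← hcomp]; exact hev2
  have hsc : IsSepClosed ks := IsSepClosure.sep_closed (IsLocalRing.ResidueField ↥v.valuationSubring)
  let E := IntermediateField.adjoin ks {IsLocalRing.residue _ t}
  haveI : Algebra.IsAlgebraic ks E := IntermediateField.isAlgebraic_adjoin (by
    intro x hx
    rw [Set.mem_singleton_iff.1 hx]; exact hintegral)
  obtain ⟨n, b, hb⟩ := IsPurelyInseparable.pow_mem ks q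
    (⟨IsLocalRing.residue _ t, IntermediateField.mem_adjoin_simple_self ks _⟩ : E)
  have hb' : algebraMap ks (IsLocalRing.ResidueField ↥w.valuationSubring) b =
      IsLocalRing.residue _ t ^ q ^ n := by simpa using congrArg Subtype.val hb
  exact ⟨n, b, hb'⟩

/-- Elements of the inertia group act trivially on the whole residue field. -/
theorem RedData.inertia (S : RedData v w ι ρ) {σ : Ω ≃ₐ[F] Ω} (hσ : ρ σ = 1)
    (t : w.valuationSubring) :
    IsLocalRing.residue _ (⟨σ t, S.hO σ t t.2⟩ : w.valuationSubring) = IsLocalRing.residue _ t := by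
  obtain ⟨q, hq⟩ := ExpChar.exists ks
  obtain ⟨n, b, hb⟩ := S.residue_pow_mem t q
  rw [← map_pow] at hb
  have h := S.hρ σ ((t ^ q ^ n : w.valuationSubring) : Ω) (t ^ q ^ n).2 (S.hO σ _ (t ^ q ^ n).2) b hb
  rw [hσ, AlgEquiv.one_apply, hb] at h
  haveI : ExpChar (IsLocalRing.ResidueField ↥w.valuationSubring) q := expChar_of_injective_ringHom ι.injective q
  have h2 : (IsLocalRing.residue _ (⟨σ t, S.hO σ t t.2⟩ : w.valuationSubring)) ^ q ^ n =
      IsLocalRing.residue _ t ^ q ^ n := by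
    rw [← map_pow, ← map_pow, h]
    congr 1
    apply Subtype.ext
    simp
  exact iterateFrobenius_inj _ q n h2

end Basic

section Ded

/-- Independence of characters, in the form needed. -/
theorem dedekind_exists {k ks κ : Type} [Field k] [Field ks] [Algebra k ks] [IsGalois k ks]
    [Field κ] (ι : ks →+* κ) (U : Subgroup (ks ≃ₐ[k] ks)) (hU : IsClosed (U : Set (ks ≃ₐ[k] ks)))
    {I : Type} [Fintype I] (τ : I → (ks ≃ₐ[k] ks)) (hτ : ∀ i j, (τ i)⁻¹ * τ j ∈ U → i = j)
    (c : I → κ) (i₀ : I) (hc : c i₀ ≠ 0) :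
    ∃ b : ks, (∀ u ∈ U, u b = b) ∧ ∑ i, c i * ι (τ i b) ≠ 0 := by
  let K := IntermediateField.fixedField U
  have hK : K.fixingSubgroup = U := InfiniteGalois.fixingSubgroup_fixedField ⟨U, hU⟩
  let χ : I → (K →* κ) := fun i => ((ι : ks →* κ).comp ((τ i : ks →ₐ[k] ks) : ks →* ks)).comp
    (K.val : K →* ks)
  have hχ : Function.Injective χ := by
    intro i j hij
    apply hτ
    rw [← hK, IntermediateField.mem_fixingSubgroup_iff]
    intro x hx
    have h := DFunLike.congr_fun hij (⟨x, hx⟩ : K)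
    have h2 : τ i x = τ j x := ι.injective h
    rw [AlgEquiv.mul_apply, ← h2, ← AlgEquiv.mul_apply]
    simp
  have hli := (linearIndependent_monoidHom K κ).comp χ hχ
  by_contra hcon
  push Not at hcon
  rw [Fintype.linearIndependent_iff] at hli
  refine hc (hli c ?_ i₀)
  ext b
  have := hcon b.1 (fun u hu => by
    exact (IntermediateField.mem_fixedField_iff U b.1).1 b.2 u hu)
  simpa [χ] using this

end Ded

section Lift

variable {F : Type} [Field F] {Γ : Type} [LinearOrderedCommGroupWithZero Γ]
    {v : Valuation F Γ}
    {Ω : Type} [Field Ω] [Algebra F Ω] [IsSepClosure F Ω]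
    {Γ' : Type} [LinearOrderedCommGroupWithZero Γ'] {w : Valuation Ω Γ'}
    {ks : Type} [Field ks]
    [Algebra (IsLocalRing.ResidueField ↥v.valuationSubring) ks]
    [IsSepClosure (IsLocalRing.ResidueField ↥v.valuationSubring) ks]
    {ι : ks →+* IsLocalRing.ResidueField ↥w.valuationSubring}
    {ρ : (Ω ≃ₐ[F] Ω) →* (ks ≃ₐ[IsLocalRing.ResidueField ↥v.valuationSubring] ks)}

/-- Hensel lifting with control of the stabilizer. -/
theorem RedData.lift (S : RedData v w ι ρ) (b : ks) :
    ∃ x : w.valuationSubring, IsLocalRing.residue _ x = ι b ∧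
      ∀ σ : Ω ≃ₐ[F] Ω, ρ σ b = b → σ x = x := by
  have hG : IsGalois F Ω := inferInstance
  have hGk : IsGalois (IsLocalRing.ResidueField ↥v.valuationSubring) ks := inferInstance
  have hbint : IsIntegral (IsLocalRing.ResidueField ↥v.valuationSubring) b :=
    Algebra.IsIntegral.isIntegral b
  obtain ⟨g, hg, -, hgm⟩ := lifts_and_natDegree_eq_and_monic
    (f := IsLocalRing.residue v.valuationSubring)
    (p := minpoly (IsLocalRing.ResidueField ↥v.valuationSubring) b)
    ((lifts_iff_coeff_lifts _).2 fun i => IsLocalRing.residue_surjective _) (minpoly.monic hbint)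
  have hsepb : (minpoly (IsLocalRing.ResidueField ↥v.valuationSubring) b).Separable :=
    Algebra.IsSeparable.isSeparable _ b
  have hirr : Irreducible g := hgm.irreducible_of_irreducible_map
    (IsLocalRing.residue v.valuationSubring) g (by rw [hg]; exact minpoly.irreducible hbint)
  have hirrF : Irreducible (g.map (algebraMap v.valuationSubring F)) :=
    (hgm.irreducible_iff_irreducible_map_fraction_map).1 hirr
  have hsep : (g.map (algebraMap v.valuationSubring F)).Separable := by
    rw [separable_iff_derivative_ne_zero hirrF]
    intro h0
    rw [derivative_map] at h0
    have h1 : derivative g = 0 :=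
      (Polynomial.map_eq_zero_iff (FaithfulSMul.algebraMap_injective v.valuationSubring F)).1 h0
    have h2 : derivative (minpoly (IsLocalRing.ResidueField ↥v.valuationSubring) b) = 0 := by
      rw [← hg, derivative_map, h1, Polynomial.map_zero]
    rw [separable_iff_derivative_ne_zero (minpoly.irreducible hbint)] at hsepb
    exact hsepb h2
  have hscΩ : IsSepClosed Ω := IsSepClosure.sep_closed F
  have hsplit := IsSepClosed.splits_codomain (f := algebraMap F Ω) _ hsep
  let α : v.valuationSubring →+* w.valuationSubring :=
    ((algebraMap F Ω).comp v.valuationSubring.subtype).codRestrict w.valuationSubring.toSubring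
      (fun x => (S.mem_iff _).2 x.2)
  have hcomp : (IsLocalRing.residue w.valuationSubring).comp α =
      ι.comp
        ((algebraMap (IsLocalRing.ResidueField ↥v.valuationSubring) ks).comp
          (IsLocalRing.residue v.valuationSubring)) := by
    ext x
    exact (S.hι x.1 x.2 ((S.mem_iff _).2 x.2)).symm
  let f := g.map α
  have hfm : f.Monic := hgm.map _
  have hfΩ : f.map (algebraMap w.valuationSubring Ω) =
      (g.map (algebraMap v.valuationSubring F)).map (algebraMap F Ω) := by
    rw [Polynomial.map_map, Polynomial.map_map]; rfl
  rw [← hfΩ] at hsplit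
  have hfκ : f.map (IsLocalRing.residue w.valuationSubring) =
      (minpoly (IsLocalRing.ResidueField ↥v.valuationSubring) b).map
        (ι.comp (algebraMap (IsLocalRing.ResidueField ↥v.valuationSubring) ks)) := by
    rw [Polynomial.map_map, hcomp, ← hg, Polynomial.map_map]; rfl
  have hsplitO : f.Splits := by
    refine Polynomial.Splits.of_splits_map_of_injective
      (FaithfulSMul.algebraMap_injective w.valuationSubring Ω) hsplit ?_
    intro a ha
    have hai : IsIntegral w.valuationSubring a := by
      refine ⟨f, hfm, ?_⟩
      have := (mem_roots'.1 ha).2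
      rwa [IsRoot, eval_map] at this
    obtain ⟨y, hy⟩ := IsIntegrallyClosed.isIntegral_iff.1 hai
    exact ⟨y, hy⟩
  have hprod := hsplitO.eq_prod_roots_of_monic hfm
  have hbroot : (f.map (IsLocalRing.residue w.valuationSubring)).eval (ι b) = 0 := by
    rw [hfκ, ← Polynomial.map_map, eval_map, eval₂_at_apply, eval_map_algebraMap, minpoly.aeval, map_zero]
  have hbder : (f.map (IsLocalRing.residue w.valuationSubring)).derivative.eval (ι b) ≠ 0 := by
    intro h0
    obtain ⟨a, c, h⟩ := hsepb.map
      (f := ι.comp (algebraMap (IsLocalRing.ResidueField ↥v.valuationSubring) ks))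
    rw [← hfκ] at h
    have h1 := congrArg (fun r => r.eval (ι b)) h
    simp only [eval_add, eval_mul, hbroot, h0, mul_zero, add_zero, eval_one] at h1
    exact zero_ne_one h1
  have hex : ∃ x : w.valuationSubring, f.eval x = 0 ∧ IsLocalRing.residue _ x = ι b := by
    have h := hbroot
    rw [hprod, Polynomial.map_multiset_prod, eval_multiset_prod, Multiset.prod_eq_zero_iff] at h
    simp only [Multiset.map_map, Multiset.mem_map, Function.comp] at h
    obtain ⟨x, hx, hx2⟩ := h
    refine ⟨x, (mem_roots'.1 hx).2, ?_⟩
    simp at hx2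
    exact (sub_eq_zero.1 hx2).symm
  have huniq : ∀ x y : w.valuationSubring, f.eval x = 0 → IsLocalRing.residue _ x = ι b →
      f.eval y = 0 → IsLocalRing.residue _ y = ι b → y = x := by
    intro x y hx hxb hy hyb
    obtain ⟨q, hq⟩ := f.binomExpansion x (y - x)
    rw [add_sub_cancel, hy, hx, zero_add] at hq
    have h0 : (y - x) * (f.derivative.eval x + q * (y - x)) = 0 := by
      rw [hq]; ring
    rcases mul_eq_zero.1 h0 with h | h
    · exact sub_eq_zero.1 h
    · exfalso
      have h2 := congrArg (IsLocalRing.residue w.valuationSubring) h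
      simp only [map_add, map_mul, map_sub, hxb, hyb, sub_self, mul_zero, add_zero, map_zero] at h2
      apply hbder
      rw [derivative_map, eval_map, ← hxb, eval₂_at_apply]
      exact h2
  obtain ⟨x, hx, hxb⟩ := hex
  refine ⟨x, hxb, ?_⟩
  intro σ hσ
  have h1 := huniq x ⟨σ x, S.hO σ x x.2⟩ hx hxb ?_ ?_
  · exact congrArg Subtype.val h1
  · have hx' : (g.map (algebraMap v.valuationSubring F)).aeval (x : Ω) = 0 := by
      rw [← eval_map_algebraMap, ← hfΩ, eval_map]
      have := eval₂_at_apply (p := f) (algebraMap w.valuationSubring Ω) x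
      exact this.trans (by rw [hx, map_zero])
    have hx'' : (g.map (algebraMap v.valuationSubring F)).aeval (σ (x : Ω)) = 0 := by
      have := aeval_algHom_apply (σ : Ω →ₐ[F] Ω) (x : Ω) (g.map (algebraMap v.valuationSubring F))
      rw [hx', map_zero] at this
      exact this
    rw [← eval_map_algebraMap, ← hfΩ, eval_map] at hx''
    apply Subtype.ext
    have := eval₂_at_apply (p := f) (algebraMap w.valuationSubring Ω) ⟨σ x, S.hO σ x x.2⟩
    exact this.symm.trans hx''
  · rw [← S.hρ σ x x.2 (S.hO σ x x.2) b hxb.symm, hσ]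

end Lift

section ResLemmas

variable {Ω : Type} [Field Ω] {Γ' : Type} [LinearOrderedCommGroupWithZero Γ'] {w : Valuation Ω Γ'}

theorem res_ne_zero_iff (t : w.valuationSubring) :
    IsLocalRing.residue _ t ≠ 0 ↔ w t = 1 := by
  have ht : w t ≤ 1 := (Valuation.mem_valuationSubring_iff _ _).1 t.2
  rw [IsLocalRing.residue_ne_zero_iff_isUnit]
  constructor
  · intro h
    obtain ⟨s, hs⟩ := h.exists_right_inv
    have hs1 : w s ≤ 1 := (Valuation.mem_valuationSubring_iff _ _).1 s.2
    have h2 : w t * w s = 1 := by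
      rw [← map_mul]
      have := congrArg (fun r : w.valuationSubring => w r) hs
      simpa using this
    refine le_antisymm ht ?_
    calc (1 : Γ') = w t * w s := h2.symm
      _ ≤ w t * 1 := by gcongr
      _ = w t := mul_one _
  · intro h
    have h0 : (t : Ω) ≠ 0 := by
      intro h0; rw [h0, map_zero] at h; exact zero_ne_one h
    refine IsUnit.of_mul_eq_one ⟨(t : Ω)⁻¹, ?_⟩ ?_
    · rw [Valuation.mem_valuationSubring_iff, map_inv₀, h, inv_one]
    · apply Subtype.ext
      simp [h0]

theorem res_eq_iff (s t : w.valuationSubring) :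
    IsLocalRing.residue _ s = IsLocalRing.residue _ t ↔ w (s - t : Ω) < 1 := by
  have h := res_ne_zero_iff (s - t)
  have h1 : w ((s - t : w.valuationSubring) : Ω) ≤ 1 :=
    (Valuation.mem_valuationSubring_iff _ _).1 (s - t).2
  rw [map_sub, sub_ne_zero] at h
  constructor
  · intro h2
    exact lt_of_le_of_ne h1 (fun h3 => h.2 h3 h2)
  · intro h2
    by_contra h3
    exact h2.ne (h.1 h3)

end ResLemmas

section Cosets

variable {F : Type} [Field F] {Γ : Type} [LinearOrderedCommGroupWithZero Γ]
    {v : Valuation F Γ}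
    {Ω : Type} [Field Ω] [Algebra F Ω] [IsSepClosure F Ω]
    {Γ' : Type} [LinearOrderedCommGroupWithZero Γ'] {w : Valuation Ω Γ'}
    {ks : Type} [Field ks]
    [Algebra (IsLocalRing.ResidueField ↥v.valuationSubring) ks]
    [IsSepClosure (IsLocalRing.ResidueField ↥v.valuationSubring) ks]
    {ι : ks →+* IsLocalRing.ResidueField ↥w.valuationSubring}
    {ρ : (Ω ≃ₐ[F] Ω) →* (ks ≃ₐ[IsLocalRing.ResidueField ↥v.valuationSubring] ks)}

theorem isOpen_stab {F Ω : Type} [Field F] [Field Ω] [Algebra F Ω] [IsGalois F Ω] (y : Ω) :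
    IsOpen {σ : Ω ≃ₐ[F] Ω | σ y = y} := by
  exact stabilizer_isOpen_of_isIntegral (K := F) y

theorem RedData.dedekind (S : RedData v w ι ρ) (H : Subgroup (Ω ≃ₐ[F] Ω))
    (hH : IsClosed (H : Set (Ω ≃ₐ[F] Ω))) (V : Subgroup H) (hV : IsOpen (V : Set H))
    (hN : ∀ h : H, ρ h = 1 → h ∈ V) [Fintype (H ⧸ V)]
    (c : H ⧸ V → IsLocalRing.ResidueField ↥w.valuationSubring) (i₀ : H ⧸ V) (hc : c i₀ ≠ 0) :
    ∃ b : ks, (∀ h ∈ V, ρ h b = b) ∧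
      ∑ i : H ⧸ V, c i * ι (ρ (i.out : H) b) ≠ 0 := by
  have hGk : IsGalois (IsLocalRing.ResidueField ↥v.valuationSubring) ks := inferInstance
  have hG : IsGalois F Ω := inferInstance
  haveI : CompactSpace H := isCompact_iff_compactSpace.1 hH.isCompact
  have hVc : IsClosed (V : Set H) := V.isClosed_of_isOpen hV
  let ρH : H →* (ks ≃ₐ[IsLocalRing.ResidueField ↥v.valuationSubring] ks) := ρ.comp H.subtype
  have hρH : Continuous ρH := S.hcont.comp continuous_subtype_val
  have hU : IsClosed ((V.map ρH : Subgroup _) :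
      Set (ks ≃ₐ[IsLocalRing.ResidueField ↥v.valuationSubring] ks)) := by
    rw [Subgroup.coe_map]
    exact (hVc.isCompact.image hρH).isClosed
  obtain ⟨b, hb, hb2⟩ := dedekind_exists ι (V.map ρH) hU (fun i : H ⧸ V => ρH i.out) (by
    intro i j hij
    obtain ⟨u, hu, hu2⟩ := Subgroup.mem_map.1 hij
    have h1 : ρH (u⁻¹ * (i.out⁻¹ * j.out)) = 1 := by
      rw [map_mul, map_inv, hu2, map_mul, map_inv, inv_mul_cancel]
    have h2 := V.mul_mem hu (hN (u⁻¹ * (i.out⁻¹ * j.out)) h1)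
    rw [mul_inv_cancel_left] at h2
    rw [← QuotientGroup.out_eq' i, ← QuotientGroup.out_eq' j]
    exact QuotientGroup.eq.2 h2) c i₀ hc
  refine ⟨b, fun h hh => hb _ (Subgroup.mem_map_of_mem _ hh), hb2⟩

/-- Elements fixed by the inertia group do not enlarge the value group. -/
theorem RedData.unram (S : RedData v w ι ρ) (H : Subgroup (Ω ≃ₐ[F] Ω))
    (hH : IsClosed (H : Set (Ω ≃ₐ[F] Ω))) (y : Ω) (hy : y ≠ 0)
    (hN : ∀ h ∈ H, ρ h = 1 → h y = y) :
    ∃ a : Ω, (∀ h ∈ H, h a = a) ∧ w a = w y := by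
  have hG : IsGalois F Ω := inferInstance
  haveI : CompactSpace H := isCompact_iff_compactSpace.1 hH.isCompact
  let V : Subgroup H := (MulAction.stabilizer (Ω ≃ₐ[F] Ω) y).comap H.subtype
  have hVmem : ∀ h : H, h ∈ V ↔ (h : Ω ≃ₐ[F] Ω) y = y := fun h => Iff.rfl
  have hVo : IsOpen (V : Set H) := (isOpen_stab (F := F) y).preimage continuous_subtype_val
  haveI : Finite (H ⧸ V) := Subgroup.quotient_finite_of_isOpen V hVo
  letI : Fintype (H ⧸ V) := Fintype.ofFinite _
  have hwy : w y ≠ 0 := by simpa using hy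
  have hmem : ∀ σ : Ω ≃ₐ[F] Ω, w (σ y / y) = 1 := by
    intro σ
    rw [map_div₀, S.isom, div_self hwy]
  let u : (Ω ≃ₐ[F] Ω) → w.valuationSubring := fun σ => ⟨σ y / y, by
    rw [Valuation.mem_valuationSubring_iff]; exact (hmem σ).le⟩
  obtain ⟨b, hb, hb2⟩ := S.dedekind H hH V hVo (fun h hh => (hVmem h).2 (hN h h.2 hh))
    (fun i => IsLocalRing.residue _ (u (i.out : H))) (QuotientGroup.mk 1)
    ((res_ne_zero_iff _).2 (hmem _))
  obtain ⟨x, hx, hx2⟩ := S.lift b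
  let f : H ⧸ V → Ω := fun i => (i.out : H).1 (y * x)
  have hf : ∀ g : H, f (QuotientGroup.mk g) = g.1 (y * x) := by
    intro g
    obtain ⟨s, hs⟩ := QuotientGroup.mk_out_eq_mul V g
    simp only [f, hs]
    rw [Subgroup.coe_mul, AlgEquiv.mul_apply, map_mul (s : H).1, (hVmem s).1 s.2,
      hx2 _ (hb s s.2)]
  refine ⟨∑ i, f i, ?_, ?_⟩
  · intro h hh
    rw [map_sum]
    refine Fintype.sum_equiv (MulAction.toPerm (⟨h, hh⟩ : H)) _ _ ?_
    intro i
    obtain ⟨g, rfl⟩ := QuotientGroup.mk_surjective i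
    rw [MulAction.toPerm_apply, MulAction.Quotient.smul_mk, hf, hf]
    rfl
  · let z : w.valuationSubring := ∑ i : H ⧸ V, u (i.out : H) *
      ⟨(i.out : H).1 x, S.hO _ _ x.2⟩
    have hz : IsLocalRing.residue _ z ≠ 0 := by
      simp only [z, map_sum, map_mul]
      convert hb2 using 4 with i
      exact (S.hρ _ x x.2 _ b hx.symm).symm
    rw [res_ne_zero_iff] at hz
    have : ∑ i, f i = y * z := by
      simp only [z]
      push_cast
      rw [Finset.mul_sum]
      refine Finset.sum_congr rfl fun i _ => ?_
      simp only [f, u, map_mul]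
      field_simp
    rw [this, map_mul, hz, mul_one]

end Cosets

section Tame

theorem charP_of_prime_zero {K : Type} [Field K] {p : ℕ} (hp : p.Prime) (h : (p : K) = 0) :
    CharP K p := by
  obtain ⟨q, hq⟩ := CharP.exists K
  have hd : q ∣ p := (CharP.cast_eq_zero_iff K q p).1 h
  rcases (Nat.dvd_prime hp).1 hd with h1 | h1
  · subst h1
    exact absurd rfl (CharP.char_ne_one K 1)
  · rwa [← h1]

theorem pow_eq_one_wild {K : Type} [Field K] (z : K) (n : ℕ) (hn : n ≠ 0)
    (h : ∀ l : ℕ, l.Prime → l ∣ n → (l : K) = 0) (hz : z ^ n = 1) : z = 1 := by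
  induction n using induction_on_primes with
  | zero => exact absurd rfl hn
  | one => simpa using hz
  | prime_mul p a hp ih =>
    have hp0 := h p hp (dvd_mul_right _ _)
    haveI := charP_of_prime_zero hp hp0
    haveI := Fact.mk hp
    have h1 : (z ^ a - 1) ^ p = 0 := by
      rw [sub_pow_char, one_pow, ← pow_mul, mul_comm a p, hz, sub_self]
    refine ih (by rintro rfl; simp at hn) (fun l hl hd => h l hl (hd.mul_left _)) ?_
    exact sub_eq_zero.1 (pow_eq_zero_iff hp.ne_zero |>.1 h1)

/-- `H` is minimal among closed subgroups surjecting onto the target. -/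
structure IsMinSurj {G Q : Type} [Group G] [TopologicalSpace G] [Group Q] (ρ : G →* Q)
    (H : Subgroup G) : Prop where
  closed : IsClosed (H : Set G)
  surj : ∀ q, ∃ h ∈ H, ρ h = q
  min : ∀ H' : Subgroup G, H' ≤ H → IsClosed (H' : Set G) → (∀ q, ∃ h ∈ H', ρ h = q) → H ≤ H'

variable {F : Type} [Field F] {Γ : Type} [LinearOrderedCommGroupWithZero Γ]
    {v : Valuation F Γ}
    {Ω : Type} [Field Ω] [Algebra F Ω] [IsSepClosure F Ω]
    {Γ' : Type} [LinearOrderedCommGroupWithZero Γ'] {w : Valuation Ω Γ'}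
    {ks : Type} [Field ks]
    [Algebra (IsLocalRing.ResidueField ↥v.valuationSubring) ks]
    [IsSepClosure (IsLocalRing.ResidueField ↥v.valuationSubring) ks]
    {ι : ks →+* IsLocalRing.ResidueField ↥w.valuationSubring}
    {ρ : (Ω ≃ₐ[F] Ω) →* (ks ≃ₐ[IsLocalRing.ResidueField ↥v.valuationSubring] ks)}

theorem w_nat_eq_one {l : ℕ} (hl : (l : IsLocalRing.ResidueField ↥w.valuationSubring) ≠ 0) :
    w (l : Ω) = 1 := by
  have := (res_ne_zero_iff (w := w) (l : w.valuationSubring)).1 (by simpa using hl)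
  simpa using this

theorem root_unity_inj {l : ℕ} (hl : (l : IsLocalRing.ResidueField ↥w.valuationSubring) ≠ 0)
    (μ : w.valuationSubring) (hμ : μ ^ l = 1) (h1 : IsLocalRing.residue _ μ = 1) : μ = 1 := by
  by_contra hne
  have h2 : (∑ i ∈ Finset.range l, μ ^ i) = 0 := by
    have := geom_sum_mul μ l
    rw [hμ, sub_self] at this
    exact (mul_eq_zero.1 this).resolve_right (sub_ne_zero.2 hne)
  have h3 := congrArg (IsLocalRing.residue w.valuationSubring) h2
  rw [map_sum] at h3
  simp [h1] at h3
  exact hl h3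

theorem RedData.tame_step (S : RedData v w ι ρ) {H : Subgroup (Ω ≃ₐ[F] Ω)}
    (hH : IsMinSurj ρ H) {l : ℕ} (hlp : l.Prime)
    (hl : (l : IsLocalRing.ResidueField ↥w.valuationSubring) ≠ 0)
    {a z : Ω} (hz : z ≠ 0) (ha : ∀ h ∈ H, h a = a) (hza : w z ^ l = w a) :
    ∃ a' : Ω, (∀ h ∈ H, h a' = a') ∧ w a' = w z := by
  have hG : IsGalois F Ω := inferInstance
  have hscΩ : IsSepClosed Ω := IsSepClosure.sep_closed F
  have hlΩ : (l : Ω) ≠ 0 := by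
    intro h0
    have := w_nat_eq_one hl
    rw [h0, map_zero] at this
    exact zero_ne_one this
  haveI : NeZero (l : Ω) := ⟨hlΩ⟩
  obtain ⟨y, hy⟩ := IsSepClosed.exists_pow_nat_eq a l
  have hwz : w z ≠ 0 := by simpa using hz
  have hwy : w y = w z := by
    have : w y ^ l = w z ^ l := by rw [hza, ← hy, map_pow]
    exact (pow_left_inj₀ zero_le zero_le hlp.ne_zero).1 this
  have hy0 : y ≠ 0 := by
    rintro rfl; rw [map_zero] at hwy; exact hwz hwy.symm
  by_cases hN : ∀ h ∈ H, ρ h = 1 → h y = y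
  · rw [← hwy]; exact S.unram H hH.closed y hy0 hN
  exfalso
  push Not at hN
  obtain ⟨n, hnH, hn1, hny⟩ := hN
  have hroot : ∀ h ∈ H, (h y / y) ^ l = 1 := by
    intro h hh
    rw [div_pow, ← map_pow, hy, ha h hh, div_self]
    rw [← hy]; exact pow_ne_zero _ hy0
  set ζ := n y / y with hζ
  have hζl : ζ ^ l = 1 := hroot n hnH
  have hζ1 : ζ ≠ 1 := by
    rw [hζ, Ne, div_eq_one_iff_eq hy0]; exact hny
  have hprim : IsPrimitiveRoot ζ l := by
    have := orderOf_eq_prime (p := l) (hp := ⟨hlp⟩) hζl hζ1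
    rw [← this]; exact IsPrimitiveRoot.orderOf ζ
  have hζ0 : ζ ≠ 0 := hprim.ne_zero hlp.ne_zero
  have hwζ : w ζ = 1 := by
    rw [hζ, map_div₀, S.isom, div_self]; rw [hwy]; exact hwz
  have hnζ : n ζ = ζ := by
    have hmem : ζ ∈ w.valuationSubring := by rw [Valuation.mem_valuationSubring_iff]; exact hwζ.le
    have hmem' : ζ⁻¹ ∈ w.valuationSubring := by
      rw [Valuation.mem_valuationSubring_iff, map_inv₀, hwζ, inv_one]
    have h1 := S.inertia hn1 ⟨ζ, hmem⟩
    have h2 := root_unity_inj hl ((⟨n ζ, S.hO n _ hmem⟩ : w.valuationSubring) * ⟨ζ⁻¹, hmem'⟩)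
      (by
        apply Subtype.ext
        simp only [MulMemClass.coe_mul, OneMemClass.coe_one, SubmonoidClass.coe_pow]
        rw [mul_pow, ← map_pow, inv_pow, hζl]; simp)
      (by
        rw [map_mul, h1, ← map_mul]
        have : (⟨ζ, hmem⟩ : w.valuationSubring) * ⟨ζ⁻¹, hmem'⟩ = 1 := by
          apply Subtype.ext; simp [hζ0]
        rw [this, map_one])
    have h3 := congrArg Subtype.val h2
    simp only [MulMemClass.coe_mul, OneMemClass.coe_one] at h3
    field_simp at h3
    exact h3
  have hnj : ∀ j : ℕ, (n ^ j) y = ζ ^ j * y := by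
    intro j
    induction j with
    | zero => simp
    | succ j ih =>
      rw [pow_succ', AlgEquiv.mul_apply, ih, map_mul, map_pow, hnζ, pow_succ]
      rw [mul_assoc]; congr 1; rw [hζ]; field_simp
  have hle := hH.min (H ⊓ MulAction.stabilizer (Ω ≃ₐ[F] Ω) y) inf_le_left
    (by
      rw [Subgroup.coe_inf]
      exact hH.closed.inter (Subgroup.isClosed_of_isOpen _ (isOpen_stab (F := F) y)))
    (by
      intro q
      obtain ⟨h, hh, rfl⟩ := hH.surj q
      haveI := NeZero.mk hlp.ne_zero
      obtain ⟨j, -, hj⟩ := hprim.eq_pow_of_pow_eq_one (hroot h hh)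
      have hhy : h y = (n ^ j) y := by
        rw [hnj, hj]; field_simp
      refine ⟨(n ^ j)⁻¹ * h, ⟨H.mul_mem (H.inv_mem (H.pow_mem hnH j)) hh, ?_⟩, ?_⟩
      · change ((n ^ j)⁻¹ * h) y = y
        rw [AlgEquiv.mul_apply, hhy, ← AlgEquiv.mul_apply, inv_mul_cancel, AlgEquiv.one_apply]
      · rw [map_mul, map_inv, map_pow, hn1]; simp)
  exact hny (hle hnH).2

/-- For a minimal `H` the inertia group consists of wild elements. -/
theorem RedData.tame (S : RedData v w ι ρ) {H : Subgroup (Ω ≃ₐ[F] Ω)}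
    (hH : IsMinSurj ρ H) {σ : Ω ≃ₐ[F] Ω} (hσ1 : ρ σ = 1) (hσH : σ ∈ H) {x : Ω} (hx : x ≠ 0) :
    w (σ x - x) < w x := by
  classical
  have hwx : w x ≠ 0 := by simpa using hx
  have hex : ∃ n : ℕ, 0 < n ∧ ∃ a : Ω, (∀ h ∈ H, h a = a) ∧ w a = w x ^ n := by
    obtain ⟨n, hn, a, ha⟩ := S.torsion x
    exact ⟨n, hn, algebraMap F Ω a, fun h _ => by simp, ha.symm⟩
  obtain ⟨hn, a, ha, hwa⟩ := Nat.find_spec hex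
  have hmin := fun m hm => Nat.find_min hex (m := m) hm
  generalize Nat.find hex = n at *
  have hprimes : ∀ l : ℕ, l.Prime → l ∣ n →
      (l : IsLocalRing.ResidueField ↥w.valuationSubring) = 0 := by
    rintro l hl ⟨m, rfl⟩
    by_contra hl0
    have hm : 0 < m := Nat.pos_of_mul_pos_left hn
    have hlt : m < l * m := by nlinarith [hl.two_le]
    obtain ⟨a', ha', hwa'⟩ := S.tame_step hH hl hl0 (z := x ^ m) (pow_ne_zero _ hx) ha
      (by rw [map_pow, ← pow_mul, mul_comm m l, hwa])
    exact hmin m hlt ⟨hm, a', ha', by rw [hwa', map_pow]⟩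
  have ha0 : a ≠ 0 := by
    rintro rfl
    rw [map_zero] at hwa
    exact pow_ne_zero n hwx hwa.symm
  have hwt : w (x ^ n / a) = 1 := by
    rw [map_div₀, hwa, map_pow, div_self (pow_ne_zero _ hwx)]
  have hwu : w (σ x / x) = 1 := by rw [map_div₀, S.isom, div_self hwx]
  let t : w.valuationSubring := ⟨x ^ n / a, by rw [Valuation.mem_valuationSubring_iff]; exact hwt.le⟩
  let u : w.valuationSubring := ⟨σ x / x, by rw [Valuation.mem_valuationSubring_iff]; exact hwu.le⟩
  have hut : u ^ n * t = ⟨σ t, S.hO σ t t.2⟩ := by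
    apply Subtype.ext
    simp only [u, t, MulMemClass.coe_mul, SubmonoidClass.coe_pow, map_div₀, map_pow, ha σ hσH]
    field_simp
    rw [div_pow, div_mul_cancel₀ _ (pow_ne_zero _ hx)]
  have h1 := congrArg (IsLocalRing.residue w.valuationSubring) hut
  rw [S.inertia hσ1 t, map_mul, map_pow] at h1
  have ht0 : IsLocalRing.residue _ t ≠ 0 := (res_ne_zero_iff t).2 hwt
  have h2 := pow_eq_one_wild _ n hn.ne' hprimes (mul_eq_right₀ ht0 |>.1 h1)
  rw [← map_one (IsLocalRing.residue w.valuationSubring), res_eq_iff] at h2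
  have h3 : σ x - x = ((u : Ω) - ((1 : w.valuationSubring) : Ω)) * x := by
    simp only [u, OneMemClass.coe_one]; field_simp
  rw [h3, map_mul]
  calc _ < 1 * w x := by
        exact mul_lt_mul_of_pos_right h2 (zero_lt_iff.2 hwx)
    _ = w x := one_mul _

end Tame

section ProP

variable {F : Type} [Field F] {Γ : Type} [LinearOrderedCommGroupWithZero Γ]
    {v : Valuation F Γ}
    {Ω : Type} [Field Ω] [Algebra F Ω] [IsSepClosure F Ω]
    {Γ' : Type} [LinearOrderedCommGroupWithZero Γ'] {w : Valuation Ω Γ'}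
    {ks : Type} [Field ks]
    [Algebra (IsLocalRing.ResidueField ↥v.valuationSubring) ks]
    [IsSepClosure (IsLocalRing.ResidueField ↥v.valuationSubring) ks]
    {ι : ks →+* IsLocalRing.ResidueField ↥w.valuationSubring}
    {ρ : (Ω ≃ₐ[F] Ω) →* (ks ≃ₐ[IsLocalRing.ResidueField ↥v.valuationSubring] ks)}

/-- The wild inertia group is pro-`p`. -/
theorem RedData.proP (S : RedData v w ι ρ) {H : Subgroup (Ω ≃ₐ[F] Ω)}
    (hH : IsMinSurj ρ H) {σ : Ω ≃ₐ[F] Ω} (hσ1 : ρ σ = 1) (hσH : σ ∈ H) {l : ℕ}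
    (hl : (l : IsLocalRing.ResidueField ↥w.valuationSubring) ≠ 0) {x : Ω}
    (hx : (σ ^ l) x = x) : σ x = x := by
  have hwl := w_nat_eq_one hl
  have hlΩ : (l : Ω) ≠ 0 := by
    intro h0
    rw [h0, map_zero] at hwl
    exact zero_ne_one hwl
  set T := ∑ i ∈ Finset.range l, (σ ^ i) x with hT
  have hσT : σ T = T := by
    have h1 : σ T = ∑ i ∈ Finset.range l, (σ ^ (i + 1)) x := by
      rw [hT, map_sum]
      refine Finset.sum_congr rfl fun i _ => ?_
      rw [pow_succ', AlgEquiv.mul_apply]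
    have h2 := Finset.sum_range_succ (fun i => (σ ^ i) x) l
    have h3 := Finset.sum_range_succ' (fun i => (σ ^ i) x) l
    rw [h2] at h3
    simp only [hx, pow_zero, AlgEquiv.one_apply] at h3
    rw [h1, hT]
    exact (add_right_cancel h3).symm
  have hσiT : ∀ i : ℕ, (σ ^ i) T = T := by
    intro i
    induction i with
    | zero => simp
    | succ i ih => rw [pow_succ', AlgEquiv.mul_apply, ih, hσT]
  set y := (l : Ω) * x - T with hy
  by_cases hy0 : y = 0
  · have h1 : (l : Ω) * x = T := sub_eq_zero.1 hy0
    have h2 := congrArg σ h1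
    rw [hσT, ← h1, map_mul, map_natCast] at h2
    exact mul_left_cancel₀ hlΩ h2
  · exfalso
    have hwy : w y ≠ 0 := by simpa using hy0
    have hsum : ∑ i ∈ Finset.range l, (σ ^ i) y = 0 := by
      simp only [hy, map_sub, map_mul, map_natCast, hσiT, Finset.sum_sub_distrib,
        ← Finset.mul_sum, ← hT, Finset.sum_const, Finset.card_range, nsmul_eq_mul, sub_self]
    have h1 : ∑ i ∈ Finset.range l, ((σ ^ i) y - y) = -((l : Ω) * y) := by
      rw [Finset.sum_sub_distrib, hsum]; simp
    have h2 : w (∑ i ∈ Finset.range l, ((σ ^ i) y - y)) < w y := by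
      refine Valuation.map_sum_lt w hwy ?_
      intro i _
      exact S.tame hH (by rw [map_pow, hσ1, one_pow]) (H.pow_mem hσH i) hy0
    rw [h1, Valuation.map_neg, map_mul, hwl, one_mul] at h2
    exact lt_irrefl _ h2

end ProP

section WildAbstract

open TensorProduct

theorem exists_zmod_of_pow_eq {K : Type} [Field K] {p : ℕ} [Fact p.Prime] [CharP K p]
    {c : K} (hc : c ^ p = c) : ∃ z : ZMod p, ZMod.castHom dvd_rfl K z = c := by
  classical
  have hp := (Fact.out : p.Prime)
  have hinj : Function.Injective (ZMod.castHom (dvd_refl p) K) := RingHom.injective _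
  have hne : (X ^ p - X : K[X]) ≠ 0 := FiniteField.X_pow_card_sub_X_ne_zero K hp.one_lt
  have hsub : Finset.univ.image (ZMod.castHom (dvd_refl p) K) ⊆ (X ^ p - X : K[X]).roots.toFinset := by
    intro y hy
    obtain ⟨z, -, rfl⟩ := Finset.mem_image.1 hy
    rw [Multiset.mem_toFinset, mem_roots hne]
    simp only [IsRoot, eval_sub, eval_pow, eval_X]
    rw [← map_pow, ZMod.pow_card, sub_self]
  have hcard : (X ^ p - X : K[X]).roots.toFinset.card ≤
      (Finset.univ.image (ZMod.castHom (dvd_refl p) K)).card := by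
    rw [Finset.card_image_of_injective _ hinj, Finset.card_univ, ZMod.card]
    refine (Multiset.toFinset_card_le _).trans ((card_roots' _).trans ?_)
    rw [FiniteField.X_pow_card_sub_X_natDegree_eq K hp.one_lt]
  have heq := Finset.eq_of_subset_of_card_le hsub hcard
  have hmem : c ∈ (X ^ p - X : K[X]).roots.toFinset := by
    rw [Multiset.mem_toFinset, mem_roots hne]
    simp [IsRoot, hc]
  rw [← heq] at hmem
  obtain ⟨z, -, hz⟩ := Finset.mem_image.1 hmem
  exact ⟨z, hz⟩

theorem exists_frob_sub {K : Type} [Field K] [IsSepClosed K] {p : ℕ} [Fact p.Prime] [CharP K p]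
    (c : K) : ∃ x : K, x ^ p - x = c := by
  have hp := (Fact.out : p.Prime)
  have hd : (X ^ p - X - C c : K[X]).degree = p := by
    have h1 : (X ^ p - X - C c : K[X]) = X ^ p - (X + C c) := by ring
    rw [h1]
    rw [degree_sub_eq_left_of_degree_lt]
    · simp
    · rw [degree_X_add_C, degree_X_pow]; exact_mod_cast hp.one_lt
  obtain ⟨x, hx⟩ := IsSepClosed.exists_root (X ^ p - X - C c : K[X])
    (by rw [hd]; exact_mod_cast hp.ne_zero) (by
      refine ⟨0, -1, ?_⟩
      have h0 : derivative (X ^ p : K[X]) = 0 := by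
        rw [derivative_X_pow, CharP.cast_eq_zero]; simp
      simp [h0])
  refine ⟨x, ?_⟩
  simp only [IsRoot, eval_sub, eval_pow, eval_X, eval_C] at hx
  exact sub_eq_zero.1 hx

variable {K A : Type} [Field K] (p : ℕ) [Fact p.Prime] [Algebra (ZMod p) K] [CharP K p]
  [AddCommGroup A] [Module (ZMod p) A]

theorem tensor_one_inj (a : A) (h : (1 : K) ⊗ₜ[ZMod p] a = 0) : a = 0 := by
  let b := Module.Free.chooseBasis (ZMod p) A
  apply b.repr.injective
  ext i
  have h2 := congrArg (fun v => (b.baseChange K).repr v i) h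
  simpa using h2

theorem tensor_frob_fixed (ψ : K →ₗ[ZMod p] K) (hψ : ∀ x, ψ x = x ^ p) (v : K ⊗[ZMod p] A)
    (hv : TensorProduct.map ψ LinearMap.id v = v) : ∃ a : A, v = 1 ⊗ₜ[ZMod p] a := by
  let b := Module.Free.chooseBasis (ZMod p) A
  have key : ∀ (v : K ⊗[ZMod p] A) i, (b.baseChange K).repr (TensorProduct.map ψ LinearMap.id v) i =
      ((b.baseChange K).repr v i) ^ p := by
    intro v i
    induction v using TensorProduct.induction_on with
    | zero => simp [(Fact.out : p.Prime).ne_zero]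
    | tmul x a => simp [hψ, Algebra.smul_def, mul_pow, ← map_pow, ZMod.pow_card]
    | add x y hx hy => simp only [map_add, Finsupp.add_apply, hx, hy, add_pow_char]
  have h1 : ∀ i, ∃ z : ZMod p, algebraMap (ZMod p) K z = (b.baseChange K).repr v i := by
    intro i
    have := key v i
    rw [hv] at this
    obtain ⟨z, hz⟩ := exists_zmod_of_pow_eq this.symm
    refine ⟨z, ?_⟩
    rw [← hz]
    congr 1
    exact Subsingleton.elim _ _
  choose z hz using h1
  have hv2 := (b.baseChange K).linearCombination_repr v
  rw [Finsupp.linearCombination_apply, Finsupp.sum] at hv2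
  refine ⟨∑ i ∈ ((b.baseChange K).repr v).support, z i • b i, ?_⟩
  rw [TensorProduct.tmul_sum]
  refine hv2.symm.trans (Finset.sum_congr rfl fun i _ => ?_)
  rw [← hz i, Module.Basis.baseChange_apply, algebraMap_smul, TensorProduct.tmul_smul]

end WildAbstract

section WildAbstract2

open TensorProduct

theorem wild_abstract {H K A : Type} [Group H] [Field K] (p : ℕ) [Fact p.Prime]
    [Algebra (ZMod p) K] [CharP K p] [AddCommGroup A] [Module (ZMod p) A]
    (act : H →* (K ≃+* K)) (D : Subgroup H) [hDn : D.Normal] [Fintype (H ⧸ D)]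
    (T : H → A →+ A) (T1 : ∀ a, T 1 a = a) (Tmul : ∀ g h a, T (g * h) a = T g (T h a))
    (α : H → A) (αmul : ∀ d ∈ D, ∀ d' ∈ D, α (d * d') = α d + α d')
    (αconj : ∀ h, ∀ d ∈ D, α (h * d * h⁻¹) = T h (α d))
    (N : Subgroup H) (hND : N ≤ D) (hN : ∀ n ∈ N, act n = 1) (hαN : ∀ a, ∃ n ∈ N, α n = a)
    (e : K) (he : ∀ d ∈ D, act d e = e) (hsum : ∑ y : H ⧸ D, act y.out e = 1)
    (AS : ∀ c : K, ∃ x, x ^ p - x = c) :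
    ∃ (H' : Subgroup H) (s : Finset K), (∀ h, ∃ n ∈ N, h * n ∈ H') ∧
      (∀ n ∈ N, n ∈ H' → α n = 0) ∧
      (∀ d ∈ D, α d = 0 → (∀ x ∈ s, act d x = x) → d ∈ H') := by
  classical
  -- basic facts on `α`
  have α1 : α 1 = 0 := by
    have := αmul 1 D.one_mem 1 D.one_mem
    rw [mul_one] at this
    exact left_eq_add.1 this
  have αinv : ∀ d ∈ D, α d + α d⁻¹ = 0 := by
    intro d hd
    rw [← αmul d hd _ (D.inv_mem hd), mul_inv_cancel, α1]
  have TD : ∀ d ∈ D, ∀ a, T d a = a := by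
    intro d hd a
    obtain ⟨n, hn, rfl⟩ := hαN a
    rw [← αconj d n (hND hn), αmul _ (D.mul_mem hd (hND hn)) _ (D.inv_mem hd),
      αmul _ hd _ (hND hn), add_right_comm, αinv d hd, zero_add]
  -- the twisted action
  let actL : H → K →ₗ[ZMod p] K := fun h => ((act h : K →+* K) : K →+ K).toZModLinearMap p
  have actL_apply : ∀ h x, actL h x = act h x := fun h x => rfl
  let M : H → (K ⊗[ZMod p] A) →ₗ[ZMod p] (K ⊗[ZMod p] A) := fun h =>
    TensorProduct.map (actL h) ((T h).toZModLinearMap p)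
  have M_tmul : ∀ h x a, M h (x ⊗ₜ a) = act h x ⊗ₜ T h a := fun h x a => rfl
  have M_smul : ∀ h (c : K) v, M h (c • v) = act h c • M h v := by
    intro h c v
    induction v using TensorProduct.induction_on with
    | zero => simp
    | tmul x a => rw [TensorProduct.smul_tmul', M_tmul, M_tmul, TensorProduct.smul_tmul',
        smul_eq_mul, smul_eq_mul, map_mul]
    | add x y hx hy => rw [smul_add, map_add, hx, hy, map_add, smul_add]
  have M_mul : ∀ g h v, M (g * h) v = M g (M h v) := by
    intro g h v
    induction v using TensorProduct.induction_on with
    | zero => simp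
    | tmul x a => rw [M_tmul, M_tmul, M_tmul, Tmul, map_mul]; rfl
    | add x y hx hy => rw [map_add, hx, hy, map_add, map_add]
  have M_one : ∀ v, M 1 v = v := by
    intro v
    induction v using TensorProduct.induction_on with
    | zero => simp
    | tmul x a => rw [M_tmul, T1, map_one]; rfl
    | add x y hx hy => rw [map_add, hx, hy]
  -- partition of unity
  let ε : H ⧸ D → K := fun y => act y.out e
  have hε : ∀ g y, act g (ε y) = ε (g • y) := by
    intro g y
    have h1 : ((g • y).out)⁻¹ * (g * y.out) ∈ D := by
      rw [← QuotientGroup.eq, QuotientGroup.out_eq']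
      conv_lhs => rw [← QuotientGroup.out_eq' y]
      rfl
    have h2 : g * y.out = (g • y).out * (((g • y).out)⁻¹ * (g * y.out)) := by group
    have h3 : act g (ε y) = act (g * y.out) e := by rw [map_mul]; rfl
    rw [h3, h2, map_mul]
    change act (g • y).out (act _ e) = _
    rw [he _ h1]
  have hεsum : ∑ y, ε y = 1 := hsum
  let κ : H ⧸ D → H → H := fun y h => h * (h⁻¹ • y).out * y.out⁻¹
  have hκ : ∀ y h, κ y h ∈ D := by
    intro y h
    apply hDn.mem_comm
    change (y.out)⁻¹ * (h * (h⁻¹ • y).out) ∈ D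
    rw [← QuotientGroup.eq, QuotientGroup.out_eq']
    have : ((h * (h⁻¹ • y).out : H) : H ⧸ D) = h • (((h⁻¹ • y).out : H) : H ⧸ D) := rfl
    rw [this, QuotientGroup.out_eq', smul_inv_smul]
  have hκmul : ∀ y g h, κ y (g * h) = (g * κ (g⁻¹ • y) h * g⁻¹) * κ y g := by
    intro y g h
    simp only [κ, mul_inv_rev, mul_smul]
    group
  let γ : H → K ⊗[ZMod p] A := fun h => ∑ y, ε y ⊗ₜ[ZMod p] α (κ y h)
  have hγmul : ∀ g h, γ (g * h) = γ g + M g (γ h) := by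
    intro g h
    have h1 : M g (γ h) = ∑ y, ε y ⊗ₜ[ZMod p] T g (α (κ (g⁻¹ • y) h)) := by
      simp only [γ, map_sum, M_tmul, hε]
      refine Fintype.sum_equiv (MulAction.toPerm g) _ _ fun y => ?_
      simp
    rw [h1]
    simp only [γ]
    rw [← Finset.sum_add_distrib]
    refine Finset.sum_congr rfl fun y _ => ?_
    rw [hκmul, αmul _ (hDn.conj_mem _ (hκ _ _) g) _ (hκ _ _), αconj _ _ (hκ _ _),
      TensorProduct.tmul_add, add_comm]
  have hDy : ∀ d ∈ D, ∀ y : H ⧸ D, d • y = y := by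
    intro d hd y
    conv_lhs => rw [← QuotientGroup.out_eq' y]
    conv_rhs => rw [← QuotientGroup.out_eq' y]
    change ((d * y.out : H) : H ⧸ D) = _
    rw [eq_comm, QuotientGroup.eq, ← mul_assoc]
    simpa using hDn.conj_mem d hd (y.out)⁻¹
  have hγD : ∀ d ∈ D, γ d = 1 ⊗ₜ α d := by
    intro d hd
    have : ∀ y, κ y d = d := by
      intro y
      simp only [κ, hDy _ (D.inv_mem hd)]
      group
    simp only [γ, this]
    rw [← TensorProduct.sum_tmul, hεsum]
  -- Artin–Schreier operator
  let ψ : K →ₗ[ZMod p] K := ((frobenius K p : K →+* K) : K →+ K).toZModLinearMap p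
  have hψ : ∀ x, ψ x = x ^ p := fun x => rfl
  let Δ : (K ⊗[ZMod p] A) →ₗ[ZMod p] (K ⊗[ZMod p] A) :=
    TensorProduct.map ψ LinearMap.id - LinearMap.id
  have Δ_tmul : ∀ x a, Δ (x ⊗ₜ a) = (x ^ p - x) ⊗ₜ a := by
    intro x a
    simp only [Δ, LinearMap.sub_apply, TensorProduct.map_tmul, LinearMap.id_apply, hψ,
      TensorProduct.sub_tmul]
  have ΔM : ∀ g v, Δ (M g v) = M g (Δ v) := by
    intro g v
    induction v using TensorProduct.induction_on with
    | zero => simp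
    | tmul x a => rw [M_tmul, Δ_tmul, Δ_tmul, M_tmul, map_sub, map_pow]
    | add x y hx hy => simp only [map_add, hx, hy]
  have Δsurj : ∀ v, ∃ u, Δ u = v := by
    intro v
    induction v using TensorProduct.induction_on with
    | zero => exact ⟨0, map_zero _⟩
    | tmul x a =>
      obtain ⟨c, hc⟩ := AS x
      exact ⟨c ⊗ₜ a, by rw [Δ_tmul, hc]⟩
    | add x y hx hy =>
      obtain ⟨u, hu⟩ := hx
      obtain ⟨u', hu'⟩ := hy
      exact ⟨u + u', by rw [map_add, hu, hu']⟩
  let δ : H → K ⊗[ZMod p] A := fun h => Δ (γ h)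
  have hδmul : ∀ g h, δ (g * h) = δ g + M g (δ h) := by
    intro g h
    simp only [δ, hγmul, map_add, ΔM]
  have hδD : ∀ d ∈ D, δ d = 0 := by
    intro d hd
    simp only [δ]
    rw [hγD d hd, Δ_tmul, one_pow, sub_self, TensorProduct.zero_tmul]
  have hδout : ∀ g (y : H ⧸ D), δ (g * y.out) = δ (g • y).out := by
    intro g y
    have h1 : ((g • y).out)⁻¹ * (g * y.out) ∈ D := by
      rw [← QuotientGroup.eq, QuotientGroup.out_eq']
      conv_lhs => rw [← QuotientGroup.out_eq' y]
      rfl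
    have h2 : g * y.out = (g • y).out * (((g • y).out)⁻¹ * (g * y.out)) := by group
    rw [h2, hδmul, hδD _ h1, map_zero, add_zero]
  obtain ⟨m', hm'⟩ := Δsurj (∑ y, ε y • δ y.out)
  have hm : ∀ g, M g (Δ m') = Δ m' - δ g := by
    intro g
    rw [hm', map_sum]
    have h1 : ∀ y : H ⧸ D, M g (ε y • δ y.out) = ε (g • y) • δ (g • y).out - ε (g • y) • δ g := by
      intro y
      rw [M_smul, hε, ← hδout, hδmul, smul_add, add_sub_cancel_left]
    simp only [h1]
    have h2 := Fintype.sum_equiv (MulAction.toPerm g)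
      (fun y : H ⧸ D => ε (g • y) • δ (g • y).out - ε (g • y) • δ g)
      (fun y : H ⧸ D => ε y • δ y.out - ε y • δ g) (fun y => rfl)
    rw [h2, Finset.sum_sub_distrib, ← Finset.sum_smul, hεsum, one_smul]
  let β : H → K ⊗[ZMod p] A := fun h => γ h - m' + M h m'
  have hβ : ∀ h, ∃ a, β h = 1 ⊗ₜ a := by
    intro h
    apply tensor_frob_fixed p ψ hψ
    have : Δ (β h) = 0 := by
      simp only [β, map_add, map_sub, ΔM, hm]
      change δ h - _ + _ = _
      abel
    exact sub_eq_zero.1 this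
  have hβmul : ∀ g h, β (g * h) = β g + M g (β h) := by
    intro g h
    simp only [β, hγmul, M_mul, map_add, map_sub]
    abel
  have hβ1 : β 1 = 0 := by
    have := hβmul 1 1
    rw [mul_one, M_one] at this
    exact left_eq_add.1 this
  let H' : Subgroup H :=
    { carrier := {h | β h = 0}
      mul_mem' := by
        intro a b (ha : β a = 0) (hb : β b = 0)
        change β (a * b) = 0
        rw [hβmul, ha, hb, map_zero, add_zero]
      one_mem' := hβ1
      inv_mem' := by
        intro a (ha : β a = 0)
        change β a⁻¹ = 0
        have := hβmul a⁻¹ a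
        rw [inv_mul_cancel, hβ1, ha, map_zero, add_zero] at this
        exact this.symm }
  have hH' : ∀ h, h ∈ H' ↔ β h = 0 := fun h => Iff.rfl
  have hMfix : ∀ v : K ⊗[ZMod p] A, ∃ s : Finset K, ∀ d ∈ D, (∀ x ∈ s, act d x = x) → M d v = v := by
    intro v
    induction v using TensorProduct.induction_on with
    | zero => exact ⟨∅, fun d _ _ => map_zero _⟩
    | tmul x a =>
      refine ⟨{x}, fun d hd hx => ?_⟩
      rw [M_tmul, TD d hd, hx x (Finset.mem_singleton_self x)]
    | add x y hx hy =>
      obtain ⟨s, hs⟩ := hx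
      obtain ⟨t, ht⟩ := hy
      refine ⟨s ∪ t, fun d hd h => ?_⟩
      rw [map_add, hs d hd fun z hz => h z (Finset.mem_union_left _ hz),
        ht d hd fun z hz => h z (Finset.mem_union_right _ hz)]
  obtain ⟨s, hs⟩ := hMfix m'
  refine ⟨H', s, ?_, ?_, ?_⟩
  · intro h
    obtain ⟨a, ha⟩ := hβ h
    obtain ⟨n, hn, hna⟩ := hαN (T h⁻¹ (-a))
    have hn1 : β n = 1 ⊗ₜ α n := by
      obtain ⟨t, ht⟩ := hMfix m'
      simp only [β]
      rw [ht n (hND hn) fun x _ => by rw [hN n hn]; rfl, hγD n (hND hn)]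
      abel
    refine ⟨n, hn, ?_⟩
    rw [hH', hβmul, ha, hn1, M_tmul, map_one, hna, ← Tmul, mul_inv_cancel, T1,
      ← TensorProduct.tmul_add, add_neg_cancel, TensorProduct.tmul_zero]
  · intro n hn hn'
    rw [hH'] at hn'
    apply tensor_one_inj (K := K) p
    rw [← hn']
    simp only [β]
    rw [hs n (hND hn) fun x _ => by rw [hN n hn]; rfl, hγD n (hND hn)]
    abel
  · intro d hd hα hx
    rw [hH']
    simp only [β]
    rw [hs d hd hx, hγD d hd, hα, TensorProduct.tmul_zero]
    abel

end WildAbstract2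

section GroupTheory

theorem frattini_mod {Q : Type} [Group Q] (B : Subgroup Q) [B.Normal] [Finite B] (p : ℕ)
    [hp : Fact p.Prime] (hB : IsPGroup p B) [Nontrivial B] :
    ∃ (A : Type) (_ : AddCommGroup A) (_ : Module (ZMod p) A) (φ : B → A) (T : Q → A →+ A),
      Function.Surjective φ ∧ (∀ b c, φ (b * c) = φ b + φ c) ∧
      (∀ q b, φ (MulAut.conjNormal q b) = T q (φ b)) ∧ Nontrivial A := by
  let G0 := Additive (Abelianization B)
  let R : AddSubgroup G0 := (nsmulAddMonoidHom (α := G0) p).range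
  have hpA : ∀ x : G0 ⧸ R, p • x = 0 := by
    intro x
    induction x using QuotientAddGroup.induction_on with
    | H z =>
      rw [← QuotientAddGroup.mk_nsmul, QuotientAddGroup.eq_zero_iff]
      exact ⟨z, rfl⟩
  let g : Q → G0 →+ G0 := fun q =>
    MonoidHom.toAdditive (Abelianization.map (MulAut.conjNormal q : MulAut B).toMonoidHom)
  refine ⟨G0 ⧸ R, inferInstance, AddCommGroup.zmodModule hpA,
    fun b => ((Additive.ofMul (Abelianization.of b) : G0) : G0 ⧸ R),
    fun q => QuotientAddGroup.map R R (g q) ?_, ?_, ?_, ?_, ?_⟩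
  · rintro _ ⟨z, rfl⟩
    exact ⟨g q z, by simp⟩
  · intro x
    induction x using QuotientAddGroup.induction_on with
    | H z =>
      obtain ⟨b, hb⟩ := QuotientGroup.mk_surjective (Additive.toMul z)
      exact ⟨b, congrArg (fun t : G0 => (t : G0 ⧸ R)) hb⟩
  · intro b c
    beta_reduce
    rw [map_mul]; rfl
  · intro q b
    rfl
  · by_contra hA
    rw [not_nontrivial_iff_subsingleton] at hA
    have hall : ∀ z : G0, ∃ y : G0, p • y = z := by
      intro z
      have : (z : G0 ⧸ R) = 0 := Subsingleton.elim _ _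
      rw [QuotientAddGroup.eq_zero_iff] at this
      exact this
    have hdiv : ∀ k : ℕ, ∀ z : G0, ∃ y : G0, p ^ k • y = z := by
      intro k
      induction k with
      | zero => intro z; exact ⟨z, by simp⟩
      | succ k ih =>
        intro z
        obtain ⟨y, hy⟩ := ih z
        obtain ⟨x, hx⟩ := hall y
        exact ⟨x, by rw [pow_succ, mul_nsmul', hx, hy]⟩
    obtain ⟨k, hk⟩ := IsPGroup.iff_card.1 hB
    have hz : ∀ z : G0, z = 0 := by
      intro z
      obtain ⟨y, rfl⟩ := hdiv k z
      obtain ⟨b, hb⟩ := QuotientGroup.mk_surjective (Additive.toMul y)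
      have h1 : y = Additive.ofMul (Abelianization.of b) := hb.symm
      rw [h1, ← ofMul_pow, ← map_pow, ← hk, pow_card_eq_one', map_one]; rfl
    have hnil := hB.isNilpotent
    have hsolv : Group.IsSolvable B := inferInstance
    have hlt := Group.IsSolvable.commutator_lt_top_of_nontrivial B
    apply hlt.ne
    rw [eq_top_iff]
    intro b _
    have := hz (Additive.ofMul (Abelianization.of b))
    have h2 : Abelianization.of b = 1 := this
    rwa [← MonoidHom.mem_ker, Abelianization.ker_of] at h2

theorem wild_module {H : Type} [Group H] (N W : Subgroup H) [N.Normal] [W.Normal] [Finite (H ⧸ W)]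
    (p : ℕ) [hp : Fact p.Prime] (hB : IsPGroup p (N.map (QuotientGroup.mk' W)))
    (hNW : ¬ N ≤ W) :
    ∃ (A : Type) (_ : AddCommGroup A) (_ : Module (ZMod p) A) (D : Subgroup H) (T : H → A →+ A)
      (α : H → A),
      D.Normal ∧ N ≤ D ∧ W ≤ D ∧
      (∀ a, T 1 a = a) ∧ (∀ g h a, T (g * h) a = T g (T h a)) ∧
      (∀ d ∈ D, ∀ d' ∈ D, α (d * d') = α d + α d') ∧
      (∀ h, ∀ d ∈ D, α (h * d * h⁻¹) = T h (α d)) ∧ (∀ a, ∃ n ∈ N, α n = a) ∧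
      (∀ x ∈ W, α x = 0) ∧ (∃ n ∈ N, α n ≠ 0) := by
  classical
  let π := QuotientGroup.mk' W
  let B := N.map π
  have hBn : B.Normal := Subgroup.Normal.map inferInstance _ (QuotientGroup.mk'_surjective W)
  have hBnt : Nontrivial B := by
    rw [Subgroup.nontrivial_iff_ne_bot]
    intro h0
    apply hNW
    have := (Subgroup.map_eq_bot_iff N).1 h0
    rwa [QuotientGroup.ker_mk'] at this
  obtain ⟨A, i1, i2, φ, T, hφs, hφm, hφT, hA⟩ := frattini_mod B p hB
  have hφ1 : φ 1 = 0 := by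
    have := hφm 1 1
    rw [mul_one] at this
    exact left_eq_add.1 this
  let α : H → A := fun d => if h : π d ∈ B then φ ⟨π d, h⟩ else 0
  have hα : ∀ d (h : π d ∈ B), α d = φ ⟨π d, h⟩ := fun d h => dif_pos h
  have hsurj : ∀ a, ∃ n ∈ N, α n = a := by
    intro a
    obtain ⟨⟨b, hb⟩, hba⟩ := hφs a
    obtain ⟨n, hn, rfl⟩ := Subgroup.mem_map.1 hb
    exact ⟨n, hn, by rw [hα n hb, hba]⟩
  refine ⟨A, i1, i2, B.comap π, fun h => T (π h), α, inferInstance, Subgroup.le_comap_map _ _,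
    ?_, ?_, ?_, ?_, ?_, hsurj, ?_, ?_⟩
  · intro x hx
    have : π x = 1 := (QuotientGroup.eq_one_iff x).2 hx
    rw [Subgroup.mem_comap, this]
    exact B.one_mem
  · intro a
    obtain ⟨b, rfl⟩ := hφs a
    beta_reduce
    rw [map_one, ← hφT, map_one]; rfl
  · intro g h a
    obtain ⟨b, rfl⟩ := hφs a
    beta_reduce
    rw [map_mul, ← hφT, ← hφT, ← hφT, map_mul]; rfl
  · intro d hd d' hd'
    rw [hα d hd, hα d' hd', ← hφm, hα (d * d') (Subgroup.mul_mem (B.comap π) hd hd')]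
    congr 1
  · intro h d hd
    have h1 : π (h * d * h⁻¹) ∈ B := by
      rw [map_mul, map_mul, map_inv]
      exact hBn.conj_mem _ hd _
    rw [hα d hd, ← hφT, hα _ h1]
    congr 1
  · intro x hx
    have h1 : π x = 1 := (QuotientGroup.eq_one_iff x).2 hx
    have h2 : π x ∈ B := by rw [h1]; exact B.one_mem
    rw [hα x h2, ← hφ1]
    congr 1
    exact Subtype.ext h1
  · obtain ⟨a, ha⟩ := exists_ne (0 : A)
    obtain ⟨n, hn, rfl⟩ := hsurj a
    exact ⟨n, hn, ha⟩

end GroupTheory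

section Final

variable {F : Type} [Field F] {Γ : Type} [LinearOrderedCommGroupWithZero Γ]
    {v : Valuation F Γ}
    {Ω : Type} [Field Ω] [Algebra F Ω] [IsSepClosure F Ω]
    {Γ' : Type} [LinearOrderedCommGroupWithZero Γ'] {w : Valuation Ω Γ'}
    {ks : Type} [Field ks]
    [Algebra (IsLocalRing.ResidueField ↥v.valuationSubring) ks]
    [IsSepClosure (IsLocalRing.ResidueField ↥v.valuationSubring) ks]
    {ι : ks →+* IsLocalRing.ResidueField ↥w.valuationSubring}
    {ρ : (Ω ≃ₐ[F] Ω) →* (ks ≃ₐ[IsLocalRing.ResidueField ↥v.valuationSubring] ks)}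

theorem RedData.ker_trivial (S : RedData v w ι ρ) {H : Subgroup (Ω ≃ₐ[F] Ω)}
    (hH : IsMinSurj ρ H) {σ : Ω ≃ₐ[F] Ω} (hσ1 : ρ σ = 1) (hσH : σ ∈ H) : σ = 1 := by
  classical
  by_contra hne
  have hG : IsGalois F Ω := inferInstance
  have hGk : IsGalois (IsLocalRing.ResidueField ↥v.valuationSubring) ks := inferInstance
  have hsc : IsSepClosed ks :=
    IsSepClosure.sep_closed (IsLocalRing.ResidueField ↥v.valuationSubring)
  haveI : CompactSpace H := isCompact_iff_compactSpace.1 hH.closed.isCompact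
  let ρH : H →* (ks ≃ₐ[IsLocalRing.ResidueField ↥v.valuationSubring] ks) := ρ.comp H.subtype
  have hρH : Continuous ρH := S.hcont.comp continuous_subtype_val
  let N : Subgroup H := ρH.ker
  have hNmem : ∀ n : H, n ∈ N ↔ ρ n = 1 := fun n => Iff.rfl
  obtain ⟨x, hx⟩ : ∃ x, σ x ≠ x := by
    by_contra hcon
    push Not at hcon
    exact hne (AlgEquiv.ext hcon)
  obtain ⟨W0, hW0⟩ := ProfiniteGrp.exist_openNormalSubgroup_sub_open_nhds_of_one
    (G := H) (U := {h : H | (h : Ω ≃ₐ[F] Ω) x = x})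
    ((isOpen_stab x).preimage continuous_subtype_val) (by simp)
  let W : Subgroup H := W0.toSubgroup
  have hWo : IsOpen (W : Set H) := W0.isOpen'
  haveI hWn : W.Normal := W0.isNormal'
  have hWx : ∀ h ∈ W, (h : Ω ≃ₐ[F] Ω) x = x := fun h hh => hW0 hh
  have hWc : IsClosed (W : Set H) := W.isClosed_of_isOpen hWo
  haveI hfin : Finite (H ⧸ W) := W.quotient_finite_of_isOpen hWo
  have hNW : ¬ N ≤ W := fun h => hx (hWx _ (h ((hNmem ⟨σ, hσH⟩).2 hσ1)))
  -- the image of `N` is a `p`-group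
  have hWG : IsClosed ((W.map H.subtype : Subgroup (Ω ≃ₐ[F] Ω)) : Set (Ω ≃ₐ[F] Ω)) := by
    rw [Subgroup.coe_map]
    exact hH.closed.isClosedEmbedding_subtypeVal.isClosedMap _ hWc
  have hprime : ∀ l : ℕ, l.Prime → l ∣ Nat.card (N.map (QuotientGroup.mk' W)) →
      (l : IsLocalRing.ResidueField ↥w.valuationSubring) = 0 := by
    intro l hl hdvd
    by_contra hl0
    haveI := Fact.mk hl
    obtain ⟨⟨b, hb⟩, hbo⟩ := exists_prime_orderOf_dvd_card' l hdvd
    obtain ⟨n, hn, rfl⟩ := Subgroup.mem_map.1 hb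
    have h1 : n ^ l ∈ W := by
      rw [← QuotientGroup.eq_one_iff]
      have := pow_orderOf_eq_one (⟨_, hb⟩ : N.map (QuotientGroup.mk' W))
      rw [hbo] at this
      exact congrArg Subtype.val this
    have h2 : n ∉ W := by
      intro hnW
      have h3 : (⟨_, hb⟩ : N.map (QuotientGroup.mk' W)) = 1 :=
        Subtype.ext ((QuotientGroup.eq_one_iff n).2 hnW)
      rw [h3, orderOf_one] at hbo
      exact hl.one_lt.ne hbo
    have h4 : (n : Ω ≃ₐ[F] Ω) ∉ (IntermediateField.fixedField (W.map H.subtype)).fixingSubgroup := by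
      have h5 := InfiniteGalois.fixingSubgroup_fixedField
        (⟨W.map H.subtype, hWG⟩ : ClosedSubgroup (Ω ≃ₐ[F] Ω))
      have h6 : (IntermediateField.fixedField (W.map H.subtype)).fixingSubgroup =
        W.map H.subtype := h5
      rw [h6]
      rintro ⟨m, hm, hmn⟩
      exact h2 (by rwa [← Subtype.ext hmn])
    rw [IntermediateField.mem_fixingSubgroup_iff] at h4
    push Not at h4
    obtain ⟨y, hy, hny⟩ := h4
    apply hny
    refine S.proP hH ((hNmem n).1 hn) n.2 hl0 ?_
    rw [IntermediateField.mem_fixedField_iff] at hy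
    exact hy _ ⟨n ^ l, h1, by simp⟩
  have hcard : Nat.card (N.map (QuotientGroup.mk' W)) ≠ 1 := by
    intro h1
    have h2 := Subgroup.eq_bot_of_card_eq _ h1
    rw [Subgroup.map_eq_bot_iff, QuotientGroup.ker_mk'] at h2
    exact hNW h2
  obtain ⟨p, hp, hpd⟩ := Nat.exists_prime_and_dvd hcard
  haveI := Fact.mk hp
  haveI hκp : CharP (IsLocalRing.ResidueField ↥w.valuationSubring) p :=
    charP_of_prime_zero hp (hprime p hp hpd)
  haveI hkp : CharP ks p := (RingHom.charP_iff ι ι.injective p).2 hκp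
  have hB : IsPGroup p (N.map (QuotientGroup.mk' W)) := by
    refine IsPGroup.of_card (Nat.eq_prime_pow_of_unique_prime_dvd Nat.card_pos.ne' ?_)
    intro d hd hdd
    have := (CharP.cast_eq_zero_iff _ p d).1 (hprime d hd hdd)
    exact ((Nat.prime_dvd_prime_iff_eq hp hd).1 this).symm
  obtain ⟨A, _, _, D, T, α, hDn, hND, hWD, T1, Tmul, αmul, αconj, hαN, hαW, n0, hn0, hαn0⟩ :=
    wild_module N W p hB hNW
  have hDo : IsOpen (D : Set H) := Subgroup.isOpen_mono hWD hWo
  haveI : Finite (H ⧸ D) := D.quotient_finite_of_isOpen hDo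
  letI : Fintype (H ⧸ D) := Fintype.ofFinite _
  letI : Algebra (ZMod p) ks := ZMod.algebra ks p
  let act : H →* (ks ≃+* ks) :=
    { toFun := fun h => (ρ h : ks ≃ₐ[IsLocalRing.ResidueField ↥v.valuationSubring] ks).toRingEquiv
      map_one' := by ext; simp
      map_mul' := by intro a b; ext; simp }
  have hact : ∀ h x, act h x = ρ h x := fun h x => rfl
  obtain ⟨b, hb, hbs⟩ := S.dedekind H hH.closed D hDo (fun h hh => hND ((hNmem h).2 hh))
    (fun _ => 1) (QuotientGroup.mk 1) one_ne_zero
  let ε : H ⧸ D → ks := fun y => act y.out b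
  have hε : ∀ g y, act g (ε y) = ε (g • y) := by
    intro g y
    have h1 : ((g • y).out)⁻¹ * (g * y.out) ∈ D := by
      rw [← QuotientGroup.eq, QuotientGroup.out_eq']
      conv_lhs => rw [← QuotientGroup.out_eq' y]
      rfl
    have h2 : g * y.out = (g • y).out * (((g • y).out)⁻¹ * (g * y.out)) := by group
    have h3 : act g (ε y) = act (g * y.out) b := by rw [map_mul]; rfl
    rw [h3, h2, map_mul]
    change act (g • y).out (act _ b) = _
    rw [hact, hact, hb _ h1]
    rfl
  let t : ks := ∑ y, ε y
  have ht0 : t ≠ 0 := by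
    intro h0
    apply hbs
    have := congrArg ι h0
    rw [map_sum, map_zero] at this
    simp only [one_mul]
    exact this
  have ht : ∀ g, act g t = t := by
    intro g
    change act g (∑ y, ε y) = ∑ y, ε y
    rw [map_sum]
    exact Fintype.sum_equiv (MulAction.toPerm g) _ _ fun y => hε g y
  obtain ⟨H', s, h1, h2, h3⟩ := wild_abstract p act D T T1 Tmul α αmul αconj N hND
    (fun n hn => by
      ext z
      rw [hact, (hNmem n).1 hn]; rfl) hαN (b / t)
    (fun d hd => by rw [map_div₀, ht, hact, hb d hd])
    (by
      simp only [map_div₀, ht]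
      rw [← Finset.sum_div]
      exact div_self ht0)
    (fun c => exists_frob_sub c)
  have hH'o : IsOpen (H' : Set H) := by
    apply Subgroup.isOpen_of_mem_nhds (g := 1)
    have hW1 : ∀ᶠ h : H in nhds 1, h ∈ W := hWo.mem_nhds W.one_mem
    have hs1 : ∀ᶠ h : H in nhds 1, ∀ x ∈ s, act h x = x := by
      rw [Finset.eventually_all]
      intro x _
      exact ((isOpen_stab x).preimage hρH).mem_nhds (by simp)
    filter_upwards [hW1, hs1] with h hh hh'
    exact h3 h (hWD hh) (hαW h hh) hh'
  have hH'c : IsClosed ((H'.map H.subtype : Subgroup (Ω ≃ₐ[F] Ω)) : Set (Ω ≃ₐ[F] Ω)) := by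
    rw [Subgroup.coe_map]
    exact hH.closed.isClosedEmbedding_subtypeVal.isClosedMap _ (H'.isClosed_of_isOpen hH'o)
  have hle := hH.min (H'.map H.subtype) (by
      rintro _ ⟨m, _, rfl⟩
      exact m.2) hH'c (by
      intro q
      obtain ⟨h, hh, hq⟩ := hH.surj q
      obtain ⟨n, hn, hhn⟩ := h1 ⟨h, hh⟩
      refine ⟨_, ⟨_, hhn, rfl⟩, ?_⟩
      rw [map_mul, map_mul]
      change ρ h * ρ n = q
      rw [(hNmem n).1 hn, mul_one, hq])
  apply hαn0
  apply h2 n0 hn0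
  obtain ⟨m, hm, hmn⟩ := hle n0.2
  rwa [← Subtype.ext hmn]

theorem exists_isMinSurj {G Q : Type} [Group G] [TopologicalSpace G] [CompactSpace G] [T2Space G]
    [Group Q] [TopologicalSpace Q] [T1Space Q] (ρ : G →* Q) (hc : Continuous ρ)
    (hs : Function.Surjective ρ) : ∃ H : Subgroup G, IsMinSurj ρ H := by
  obtain ⟨m, -, hm⟩ := zorn_le_nonempty₀ (α := (Subgroup G)ᵒᵈ)
    {H | IsClosed ((OrderDual.ofDual H : Subgroup G) : Set G) ∧
      ∀ q, ∃ h ∈ (OrderDual.ofDual H : Subgroup G), ρ h = q} (by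
    intro c hcs hchain y hy
    refine ⟨OrderDual.toDual (sInf {K : Subgroup G | OrderDual.toDual K ∈ c}), ⟨?_, ?_⟩, ?_⟩
    · rw [OrderDual.ofDual_toDual, Subgroup.coe_sInf]
      exact isClosed_biInter fun K hK => (hcs hK).1
    · intro q
      haveI : Nonempty c := ⟨⟨y, hy⟩⟩
      obtain ⟨g, hg⟩ := IsCompact.nonempty_iInter_of_directed_nonempty_isCompact_isClosed
        (fun K : c => ((OrderDual.ofDual K.1 : Subgroup G) : Set G) ∩ ρ ⁻¹' {q}) (by
          intro K L
          rcases hchain.total K.2 L.2 with h | h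
          · exact ⟨L, fun z hz => ⟨h hz.1, hz.2⟩, fun z hz => hz⟩
          · exact ⟨K, fun z hz => hz, fun z hz => ⟨h hz.1, hz.2⟩⟩)
        (by
          intro K
          obtain ⟨h, hh, hq⟩ := (hcs K.2).2 q
          exact ⟨h, hh, hq⟩)
        (fun K => ((hcs K.2).1.inter (isClosed_singleton.preimage hc)).isCompact)
        (fun K => (hcs K.2).1.inter (isClosed_singleton.preimage hc))
      rw [Set.mem_iInter] at hg
      refine ⟨g, ?_, (hg ⟨y, hy⟩).2⟩
      rw [OrderDual.ofDual_toDual, Subgroup.mem_sInf]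
      intro K hK
      exact (hg ⟨_, hK⟩).1
    · intro z hz
      exact sInf_le (a := OrderDual.ofDual z) hz) (OrderDual.toDual ⊤)
    ⟨isClosed_univ, fun q => by
      obtain ⟨g, hg⟩ := hs q
      exact ⟨g, trivial, hg⟩⟩
  refine ⟨OrderDual.ofDual m, hm.prop.1, hm.prop.2, ?_⟩
  intro H' hle hcl hsj
  exact hm.le_of_ge (y := OrderDual.toDual H') ⟨hcl, hsj⟩ hle

theorem RedData.section_exists (S : RedData v w ι ρ) :
    ∃ s : (ks ≃ₐ[IsLocalRing.ResidueField ↥v.valuationSubring] ks) →* (Ω ≃ₐ[F] Ω),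
      Continuous s ∧ ∀ τ, ρ (s τ) = τ := by
  have hG : IsGalois F Ω := inferInstance
  have hGk : IsGalois (IsLocalRing.ResidueField ↥v.valuationSubring) ks := inferInstance
  obtain ⟨H, hH⟩ := exists_isMinSurj ρ S.hcont S.hsurj
  haveI : CompactSpace H := isCompact_iff_compactSpace.1 hH.closed.isCompact
  let ρH : H →* (ks ≃ₐ[IsLocalRing.ResidueField ↥v.valuationSubring] ks) := ρ.comp H.subtype
  have hρH : Continuous ρH := S.hcont.comp continuous_subtype_val
  have hinj : Function.Injective ρH := by
    rw [injective_iff_map_eq_one]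
    intro a ha
    exact Subtype.ext (S.ker_trivial hH ha a.2)
  have hsurj : Function.Surjective ρH := by
    intro q
    obtain ⟨h, hh, hq⟩ := hH.surj q
    exact ⟨⟨h, hh⟩, hq⟩
  let E : H ≃* (ks ≃ₐ[IsLocalRing.ResidueField ↥v.valuationSubring] ks) :=
    MulEquiv.ofBijective ρH ⟨hinj, hsurj⟩
  have hE : Continuous E.toEquiv := hρH
  refine ⟨H.subtype.comp E.symm.toMonoidHom, ?_, fun τ => E.apply_symm_apply τ⟩
  exact continuous_subtype_val.comp (hE.continuous_symm_of_equiv_compact_to_t2)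

end Final

end Helpers

theorem stmt10 (F : Type) [Field F] {Γ : Type} [LinearOrderedCommGroupWithZero Γ]
    (v : Valuation F Γ) (hhens : IsHenselianValuedField F v)
    (Ω : Type) [Field Ω] [Algebra F Ω] [IsSepClosure F Ω]
    {Γ' : Type} [LinearOrderedCommGroupWithZero Γ'] (w : Valuation Ω Γ')
    (hw : (w.comap (algebraMap F Ω)).IsEquiv v)
    -- `ks` is a separable closure of the residue field `F̄` of `(F, v)`
    (ks : Type) [Field ks]
    [Algebra (IsLocalRing.ResidueField ↥v.valuationSubring) ks]
    [IsSepClosure (IsLocalRing.ResidueField ↥v.valuationSubring) ks]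
    -- `ι` identifies `ks` with the relative separable closure of `F̄` inside the residue
    -- field of `(F_s, w)`, compatibly with the residue maps:
    (ι : ks →+* IsLocalRing.ResidueField ↥w.valuationSubring)
    (hι : ∀ (x : F) (hx : x ∈ v.valuationSubring) (hx' : algebraMap F Ω x ∈ w.valuationSubring),
      ι (algebraMap (IsLocalRing.ResidueField ↥v.valuationSubring) ks
          (IsLocalRing.residue _ ⟨x, hx⟩)) = IsLocalRing.residue _ ⟨algebraMap F Ω x, hx'⟩)
    -- `ρ : G(F) → G(F̄)` is the continuous epimorphism induced by reduction at `w`: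
    (ρ : (Ω ≃ₐ[F] Ω) →* (ks ≃ₐ[IsLocalRing.ResidueField ↥v.valuationSubring] ks))
    (hρcont : Continuous ρ) (hρsurj : Function.Surjective ρ)
    (hρ : ∀ (σ : Ω ≃ₐ[F] Ω) (x : Ω) (hx : x ∈ w.valuationSubring)
        (hσx : σ x ∈ w.valuationSubring) (y : ks),
        ι y = IsLocalRing.residue _ ⟨x, hx⟩ →
          ι (ρ σ y) = IsLocalRing.residue _ ⟨σ x, hσx⟩) :
    ∃ s : (ks ≃ₐ[IsLocalRing.ResidueField ↥v.valuationSubring] ks) →* (Ω ≃ₐ[F] Ω),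
      Continuous s ∧ ∀ τ, ρ (s τ) = τ := by
  refine RedData.section_exists (v := v) (w := w) (ι := ι)
    ⟨?_, hens_mem hhens hw, hι, hρcont, hρsurj, hρ⟩
  intro x
  rw [Valuation.mem_valuationSubring_iff, Valuation.mem_valuationSubring_iff]
  exact Valuation.isEquiv_iff_val_le_one.1 hw (x := x)
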